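/- Let n be a positive natural number, k₁, …, kₙ positive natural numbers with N = k₁ + ⋯ + kₙ, and let τ be the multiset over {1, …, n} containing each i with multiplicity kᵢ. Let c : {1, …, N} → {1, …, n} be the 'collapse' map sending the first k₁ elements to 1, the next k₂ to 2, and so on (any map whose fiber over i has size kᵢ). Let f : ℝ → ℝ and y : (Fin n → ℝ) → ℝ be infinitely differentiable. Then for every point x, the mixed partial derivative ∂^N f(y) / ∂x₁^{k₁} ⋯ ∂xₙ^{kₙ} evaluated at x equals the sum, over all partitions τ₁ + τ₂ + ⋯ + τ_r of the multiset τ into nonempty multisets, of M · f^(r)(y(x)) · ∏_{i=1}^{r} ∂_{τᵢ} y(x), where ∂_{τᵢ} y denotes the mixed partial derivative of y taken, for each j ∈ {1, …, n}, as many times with respect to x_j as the multiplicity of j in τᵢ, and where the multiplicity M is the number of partitions π of the set {1, …, N} such that the multiset of multisets { c(B) : B a block of π } (each block B mapped forward by c, with multiplicity) equals the multiset partition {τ₁, …, τ_r}. -/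

import Mathlib

/-- Iterated directional (line) derivative along a list of direction vectors. -/
noncomputable def iterLineDeriv {E : Type*} [NormedAddCommGroup E] [NormedSpace ℝ E] :
    List E → (E → ℝ) → E → ℝ
  | [], g => g
  | v :: vs, g => fun x => lineDeriv ℝ (iterLineDeriv vs g) x v

/-- The mixed partial derivative `∂_τ y` associated with a multiset `τ` of indices:
`y` is differentiated, for each `j`, as many times with respect to `x_j` as the
multiplicity of `j` in `τ`. -/
noncomputable def partialDerivMul {n : ℕ} (τ : Multiset (Fin n)) (y : (Fin n → ℝ) → ℝ) :
    (Fin n → ℝ) → ℝ :=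
  iterLineDeriv (τ.toList.map fun j => Pi.single j (1 : ℝ)) y

/-- The collapse of a set partition `π` of `{1, …, N}` along a map `c : Fin N → Fin n`:
the multiset of the multiset-images `c(B)` of the blocks `B` of `π`. -/
def collapsePartition {N n : ℕ} (c : Fin N → Fin n)
    (π : Finpartition (Finset.univ : Finset (Fin N))) : Multiset (Multiset (Fin n)) :=
  π.parts.val.map fun B => B.val.map c

open Finset in
/-- Add a new element `a` to the block `B` of a partition of `S`, or add the new block `{a}`
when `B = ∅`. -/
def Finpartition.insertInto {ι : Type*} [DecidableEq ι] {S : Finset ι} {a : ι}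
    (π : Finpartition S) (ha : a ∉ S) (B : Finset ι) (hB : B ∈ insert ∅ π.parts) :
    Finpartition (insert a S) where
  parts := insert (insert a B) (π.parts.erase B)
  supIndep := by
    have key : ∀ q ∈ π.parts.erase B, Disjoint (insert a B) q := by
      intro q hq
      rw [mem_erase] at hq
      rw [disjoint_insert_left]
      refine ⟨fun h => ha (π.subset hq.2 h), ?_⟩
      rcases mem_insert.1 hB with rfl | hB
      · exact disjoint_empty_left _
      · exact π.disjoint hB hq.2 hq.1.symm
    rw [supIndep_iff_pairwiseDisjoint, coe_insert]
    refine Set.PairwiseDisjoint.insert (π.disjoint.subset (by simp)) fun q hq _ => key q hq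
  sup_parts := by
    rw [sup_insert]
    have hS := π.biUnion_parts
    have hsub : B ⊆ S := by
      rcases mem_insert.1 hB with rfl | hB
      · exact empty_subset _
      · exact π.subset hB
    ext i
    simp only [← hS, id, sup_eq_union, mem_union, mem_insert, mem_sup, mem_erase, mem_biUnion]
    constructor
    · rintro ((h | h) | ⟨q, hq, hi⟩)
      · exact Or.inl h
      · exact Or.inr (by simpa [← hS] using hsub h)
      · exact Or.inr ⟨q, hq.2, hi⟩
    · rintro (h | ⟨q, hq, hi⟩)
      · exact Or.inl (Or.inl h)
      · by_cases hqB : q = B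
        · exact Or.inl (Or.inr (hqB ▸ hi))
        · exact Or.inr ⟨q, ⟨hqB, hq⟩, hi⟩
  bot_notMem := by
    simp [eq_comm (a := (∅ : Finset ι))]

open Finset in
/-- Remove an element `a ∉ S` from a partition of `insert a S`. -/
def Finpartition.removeInserted {ι : Type*} [DecidableEq ι] {S : Finset ι} {a : ι}
    (π : Finpartition (insert a S)) (ha : a ∉ S) : Finpartition S :=
  Finpartition.ofErase (insert ((π.part a).erase a) (π.parts.erase (π.part a)))
    (by
      rw [supIndep_iff_pairwiseDisjoint, coe_insert]
      refine Set.PairwiseDisjoint.insert (π.disjoint.subset (by simp)) fun q hq _ => ?_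
      rw [mem_coe, mem_erase] at hq
      exact (π.disjoint (π.part_mem.2 (mem_insert_self a S)) hq.2 hq.1.symm).mono_left
        (erase_subset _ _))
    (by
      have hS := π.biUnion_parts
      have hpa := π.part_mem.2 (mem_insert_self a S)
      have haa := π.mem_part_self.2 (mem_insert_self a S)
      rw [sup_insert]
      ext i
      simp only [id, sup_eq_union, mem_union, mem_sup, mem_erase]
      constructor
      · rintro (⟨h1, h2⟩ | ⟨q, hq, hi⟩)
        · exact (mem_insert.1 (π.subset hpa h2)).resolve_left h1
        · refine (mem_insert.1 (π.subset hq.2 hi)).resolve_left ?_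
          rintro rfl
          exact hq.1 (π.eq_of_mem_parts hq.2 hpa hi haa)
      · intro hi
        have hia : i ≠ a := fun h => ha (h ▸ hi)
        obtain ⟨q, hq, hiq⟩ := π.exists_mem (mem_insert_of_mem hi)
        by_cases hqa : q = π.part a
        · exact Or.inl ⟨hia, hqa ▸ hiq⟩
        · exact Or.inr ⟨q, ⟨hqa, hq⟩, hiq⟩)

open Finset in
/-- The partitions of `insert a S` arise uniquely from the partitions of `S` by adding `a` to
an existing block or as a new block. -/
theorem Finpartition.sum_insert {ι M : Type*} [DecidableEq ι] [AddCommMonoid M] {S : Finset ι}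
    {a : ι} (ha : a ∉ S) (F : Finset (Finset ι) → M) :
    ∑ π : Finpartition (insert a S), F π.parts =
      ∑ π : Finpartition S, ∑ B ∈ insert ∅ π.parts,
        F (insert (insert a B) (π.parts.erase B)) := by
  rw [sum_sigma']
  symm
  have hsub : ∀ (π : Finpartition S) (B : Finset ι), B ∈ insert ∅ π.parts → a ∉ B := by
    intro π B hB h
    rcases mem_insert.1 hB with rfl | hB
    · exact notMem_empty _ h
    · exact ha (π.subset hB h)
  refine sum_bij (fun p hp => p.1.insertInto ha p.2 (mem_sigma.1 hp).2)
    (fun _ _ => mem_univ _) ?_ ?_ (fun _ _ => rfl)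
  · rintro ⟨π, B⟩ hp ⟨ρ, C⟩ hq h
    have hB := (mem_sigma.1 hp).2
    have hC := (mem_sigma.1 hq).2
    have haB : a ∉ B := hsub _ _ hB
    have haC : a ∉ C := hsub _ _ hC
    have hparts : insert (insert a B) (π.parts.erase B) = insert (insert a C) (ρ.parts.erase C) :=
      congrArg Finpartition.parts h
    have hnot : ∀ (σ : Finpartition S) (D T : Finset ι), insert a D ∉ σ.parts.erase T :=
      fun σ D T hm => ha (σ.subset (mem_of_mem_erase hm) (mem_insert_self _ _))
    have hBC : B = C := by
      have hmem : insert a B ∈ insert (insert a C) (ρ.parts.erase C) :=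
        hparts ▸ mem_insert_self _ _
      rw [mem_insert] at hmem
      have := hmem.resolve_right (hnot _ _ _)
      rw [← erase_insert haB, this, erase_insert haC]
    subst hBC
    have herase : π.parts.erase B = ρ.parts.erase B := by
      rw [← erase_insert (hnot π B B), hparts, erase_insert (hnot ρ B B)]
    have : π = ρ := by
      ext1
      by_cases hB0 : B = ∅
      · subst hB0
        rwa [erase_eq_of_notMem π.empty_notMem_parts, erase_eq_of_notMem ρ.empty_notMem_parts]
          at herase
      · rw [← insert_erase ((mem_insert.1 hB).resolve_left hB0), herase,
          insert_erase ((mem_insert.1 hC).resolve_left hB0)]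
    rw [this]
  · intro π _
    have hpa := π.part_mem.2 (mem_insert_self a S)
    have haa := π.mem_part_self.2 (mem_insert_self a S)
    have hparts : (π.removeInserted ha).parts =
      (insert ((π.part a).erase a) (π.parts.erase (π.part a))).erase ∅ := rfl
    refine ⟨⟨π.removeInserted ha, (π.part a).erase a⟩, ?_, ?_⟩
    · rw [mem_sigma]
      refine ⟨mem_univ _, ?_⟩
      rw [hparts]
      simp only [mem_insert, mem_erase, true_or, and_true]
      exact em _
    · ext1
      change insert (insert a ((π.part a).erase a))
        ((π.removeInserted ha).parts.erase ((π.part a).erase a)) = π.parts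
      have hnot : (π.part a).erase a ∉ π.parts.erase (π.part a) := by
        intro hm
        obtain ⟨i, hi⟩ := π.nonempty_of_mem_parts (mem_of_mem_erase hm)
        exact (mem_erase.1 hm).1
          (π.eq_of_mem_parts (mem_of_mem_erase hm) hpa hi (mem_of_mem_erase hi))
      rw [hparts, erase_right_comm, erase_insert hnot, erase_eq_of_notMem (a := ∅),
        insert_erase haa, insert_erase hpa]
      exact fun hm => π.empty_notMem_parts (mem_of_mem_erase hm)

theorem lineDeriv_apply_eq_fderiv {E : Type*} [NormedAddCommGroup E] [NormedSpace ℝ E]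
    {g : E → ℝ} (hg : ContDiff ℝ (⊤ : ℕ∞) g) (v : E) :
    (fun x => lineDeriv ℝ g x v) = fun x => fderiv ℝ g x v :=
  funext fun x => (hg.differentiable (by simp) x).lineDeriv_eq_fderiv

theorem ContDiff.lineDeriv_infty {E : Type*} [NormedAddCommGroup E] [NormedSpace ℝ E]
    {g : E → ℝ} (hg : ContDiff ℝ (⊤ : ℕ∞) g) (v : E) :
    ContDiff ℝ (⊤ : ℕ∞) fun x => lineDeriv ℝ g x v := by
  rw [lineDeriv_apply_eq_fderiv hg]
  exact (hg.fderiv_right (by simp)).clm_apply contDiff_const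

theorem lineDeriv_lineDeriv_comm {E : Type*} [NormedAddCommGroup E] [NormedSpace ℝ E]
    {g : E → ℝ} (hg : ContDiff ℝ (⊤ : ℕ∞) g) (v w x : E) :
    lineDeriv ℝ (fun z => lineDeriv ℝ g z v) x w =
      lineDeriv ℝ (fun z => lineDeriv ℝ g z w) x v := by
  have hd : DifferentiableAt ℝ (fderiv ℝ g) x :=
    (hg.fderiv_right (m := (⊤ : ℕ∞)) (by simp)).differentiable (by simp) x
  have key : ∀ v w : E, lineDeriv ℝ (fun z => lineDeriv ℝ g z v) x w =
      fderiv ℝ (fderiv ℝ g) x w v := by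
    intro v w
    rw [((hg.lineDeriv_infty v).differentiable (by simp) x).lineDeriv_eq_fderiv,
      lineDeriv_apply_eq_fderiv hg, fderiv_clm_apply hd (differentiableAt_const v)]
    simp
  rw [key, key]
  exact hg.contDiffAt.isSymmSndFDerivAt
    (by simpa using WithTop.coe_le_coe.2 (le_top : (2 : ℕ∞) ≤ ⊤)) w v

theorem ContDiff.iterLineDeriv {E : Type*} [NormedAddCommGroup E] [NormedSpace ℝ E]
    {g : E → ℝ} (hg : ContDiff ℝ (⊤ : ℕ∞) g) (l : List E) :
    ContDiff ℝ (⊤ : ℕ∞) (iterLineDeriv l g) := by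
  induction l with
  | nil => exact hg
  | cons v l ih => exact ih.lineDeriv_infty v

theorem iterLineDeriv_perm {E : Type*} [NormedAddCommGroup E] [NormedSpace ℝ E]
    {g : E → ℝ} (hg : ContDiff ℝ (⊤ : ℕ∞) g) {l l' : List E} (h : l.Perm l') :
    iterLineDeriv l g = iterLineDeriv l' g := by
  induction h with
  | nil => rfl
  | cons v _ ih => simp only [iterLineDeriv, ih]
  | swap v w l => exact funext fun x => lineDeriv_lineDeriv_comm (hg.iterLineDeriv l) v w x
  | trans _ _ ih ih' => exact ih.trans ih'

theorem ContDiff.partialDerivMul {n : ℕ} {g : (Fin n → ℝ) → ℝ} (hg : ContDiff ℝ (⊤ : ℕ∞) g)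
    (τ : Multiset (Fin n)) : ContDiff ℝ (⊤ : ℕ∞) (partialDerivMul τ g) :=
  hg.iterLineDeriv _

theorem partialDerivMul_zero {n : ℕ} (g : (Fin n → ℝ) → ℝ) : partialDerivMul 0 g = g := by
  simp [partialDerivMul, iterLineDeriv]

theorem partialDerivMul_cons {n : ℕ} {g : (Fin n → ℝ) → ℝ} (hg : ContDiff ℝ (⊤ : ℕ∞) g)
    (j : Fin n) (τ : Multiset (Fin n)) :
    partialDerivMul (j ::ₘ τ) g =
      fun x => lineDeriv ℝ (partialDerivMul τ g) x (Pi.single j 1) := by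
  have h : (j ::ₘ τ).toList.Perm (j :: τ.toList) := by
    rw [← Multiset.coe_eq_coe, Multiset.coe_toList, ← Multiset.cons_coe, Multiset.coe_toList]
  exact iterLineDeriv_perm hg (h.map fun j => Pi.single j (1 : ℝ))

theorem hasLineDerivAt_partialDerivMul {n : ℕ} {g : (Fin n → ℝ) → ℝ}
    (hg : ContDiff ℝ (⊤ : ℕ∞) g) (τ : Multiset (Fin n)) (j : Fin n) (x : Fin n → ℝ) :
    HasLineDerivAt ℝ (partialDerivMul τ g) (partialDerivMul (j ::ₘ τ) g x) x
      (Pi.single j 1) := by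
  rw [partialDerivMul_cons hg]
  exact ((hg.partialDerivMul τ).differentiable (by simp) x).lineDifferentiableAt.hasLineDerivAt

open Finset in
/-- Faà di Bruno's formula for the mixed partial derivative in the directions `c i`, `i ∈ S`,
as a sum over the partitions of `S`. -/
theorem partialDerivMul_comp_eq_sum_finpartition {ι : Type*} [DecidableEq ι] {n : ℕ}
    (c : ι → Fin n) {f : ℝ → ℝ} (hf : ContDiff ℝ (⊤ : ℕ∞) f) {y : (Fin n → ℝ) → ℝ}
    (hy : ContDiff ℝ (⊤ : ℕ∞) y) (S : Finset ι) (x : Fin n → ℝ) :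
    partialDerivMul (S.val.map c) (f ∘ y) x =
      ∑ π : Finpartition S, iteratedDeriv #π.parts f (y x) *
        ∏ B ∈ π.parts, partialDerivMul (B.val.map c) y x := by
  induction S using Finset.induction_on generalizing x with
  | empty =>
    have : ∀ π : Finpartition (∅ : Finset ι), π.parts = ∅ :=
      fun π => π.parts_eq_empty_iff.2 rfl
    have hcard : Fintype.card (Finpartition (∅ : Finset ι)) = 1 :=
      Fintype.card_eq_one_iff.2 ⟨Finpartition.empty _, fun π => by
        ext1; rw [this, this]⟩
    simp [this, partialDerivMul_zero, hcard]
  | insert a S ha ih =>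
    have hval : ∀ T : Finset ι, a ∉ T →
        (insert a T).val.map c = c a ::ₘ T.val.map c := fun T hT => by
      rw [insert_val_of_notMem hT, Multiset.map_cons]
    rw [hval S ha, partialDerivMul_cons (hf.comp hy), funext ih,
      Finpartition.sum_insert ha fun P => iteratedDeriv #P f (y x) *
        ∏ B ∈ P, partialDerivMul (B.val.map c) y x]
    refine HasLineDerivAt.lineDeriv (HasDerivAt.fun_sum fun π _ => ?_)
    have hline : ∀ τ : Multiset (Fin n), HasDerivAt
        (fun t : ℝ => partialDerivMul τ y (x + t • Pi.single (c a) 1))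
        (partialDerivMul (c a ::ₘ τ) y x) 0 :=
      fun τ => hasLineDerivAt_partialDerivMul hy τ (c a) x
    have hf' : HasDerivAt (iteratedDeriv #π.parts f) (iteratedDeriv (#π.parts + 1) f (y x))
        (y (x + (0 : ℝ) • Pi.single (c a) 1)) := by
      rw [zero_smul, add_zero, iteratedDeriv_succ]
      exact (hf.differentiable_iteratedDeriv #π.parts
        (by exact_mod_cast WithTop.coe_lt_top _) (y x)).hasDerivAt
    have hy' := hline 0
    rw [partialDerivMul_zero] at hy'
    have h := (hf'.comp (0 : ℝ) hy').mul (HasDerivAt.fun_finsetProd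
      fun B (_ : B ∈ π.parts) => hline (B.val.map c))
    refine h.congr_deriv ?_
    have hnot : ∀ B T : Finset ι, insert a B ∉ π.parts.erase T :=
      fun B T hm => ha (π.subset (mem_of_mem_erase hm) (mem_insert_self _ _))
    rw [sum_insert π.empty_notMem_parts, prod_insert (hnot _ _), card_insert_of_notMem (hnot _ _),
      erase_eq_of_notMem π.empty_notMem_parts, hval ∅ (notMem_empty a), mul_sum]
    simp only [zero_smul, add_zero, empty_val, Multiset.map_zero, Function.comp_apply, smul_eq_mul]
    congr 1
    · ring
    · refine sum_congr rfl fun B hB => ?_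
      rw [prod_insert (hnot _ _), card_insert_of_notMem (hnot _ _), card_erase_add_one hB,
        hval B fun h => ha (π.subset hB h), mul_comm (partialDerivMul (c a ::ₘ _) y x)]

/-- Faà di Bruno's formula for the mixed partial derivative
`∂^N f(y) / ∂x₁^{k₁} ⋯ ∂xₙ^{kₙ}`: it is the sum over all partitions
`P = τ₁ + ⋯ + τ_r` of the multiset `τ` (which contains each `i` with multiplicity `kᵢ`)
into nonempty multisets of `M · f^(r)(y x) · ∏ᵢ ∂_{τᵢ} y (x)`, where the multiplicity
`M` is the number of partitions of the set `{1, …, N}` that collapse to `P` along the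
collapse map `c`. -/
theorem mixed_partial_comp_eq_sum_multiset_partitions (n : ℕ) (hn : 0 < n)
    (k : Fin n → ℕ) (hk : ∀ i, 0 < k i) (N : ℕ) (hN : N = ∑ i, k i)
    (τ : Multiset (Fin n)) (hτ : τ = ∑ i, Multiset.replicate (k i) i)
    (c : Fin N → Fin n)
    (hc : ∀ i, (Finset.univ.filter fun a => c a = i).card = k i)
    (f : ℝ → ℝ) (hf : ContDiff ℝ (⊤ : ℕ∞) f)
    (y : (Fin n → ℝ) → ℝ) (hy : ContDiff ℝ (⊤ : ℕ∞) y) (x : Fin n → ℝ) :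
    partialDerivMul τ (f ∘ y) x =
      ∑ᶠ (P : Multiset (Multiset (Fin n)))
        (_ : P.sum = τ ∧ (0 : Multiset (Fin n)) ∉ P),
        ((Finset.univ.filter fun π : Finpartition (Finset.univ : Finset (Fin N)) =>
            collapsePartition c π = P).card : ℝ) *
          iteratedDeriv (Multiset.card P) f (y x) *
          (P.map fun σ => partialDerivMul σ y x).prod := by
  have hcτ : (Finset.univ : Finset (Fin N)).val.map c = τ := by
    ext i
    rw [hτ, Multiset.count_map, Multiset.count_sum']
    simp only [Multiset.count_replicate, Finset.sum_ite_eq', Finset.mem_univ, if_true, ← hc i]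
    simp only [Finset.card, Finset.filter_val, eq_comm]
  have hsum : ∀ π : Finpartition (Finset.univ : Finset (Fin N)),
      (collapsePartition c π).sum = τ := by
    intro π
    rw [← hcτ, ← π.biUnion_parts, ← Finset.disjiUnion_eq_biUnion _ _ π.disjoint,
      Finset.disjiUnion_val, Multiset.map_bind]
    rfl
  have hzero : ∀ π : Finpartition (Finset.univ : Finset (Fin N)),
      (0 : Multiset (Fin n)) ∉ collapsePartition c π := by
    intro π h
    obtain ⟨B, hB, h0⟩ := Multiset.mem_map.1 h
    rw [Multiset.map_eq_zero, Finset.val_eq_zero] at h0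
    exact π.ne_empty hB h0
  rw [← hcτ, partialDerivMul_comp_eq_sum_finpartition c hf hy, hcτ]
  have hterm : ∀ π : Finpartition (Finset.univ : Finset (Fin N)),
      iteratedDeriv π.parts.card f (y x) *
          ∏ B ∈ π.parts, partialDerivMul (B.val.map c) y x =
        iteratedDeriv (Multiset.card (collapsePartition c π)) f (y x) *
          ((collapsePartition c π).map fun σ => partialDerivMul σ y x).prod := by
    intro π
    rw [collapsePartition, Multiset.card_map, Multiset.map_map]
    rfl
  rw [Finset.sum_congr rfl fun π _ => hterm π,
    Finset.sum_comp (fun P : Multiset (Multiset (Fin n)) => iteratedDeriv (Multiset.card P) f (y x) *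
      (P.map fun σ => partialDerivMul σ y x).prod) (collapsePartition c)]
  simp only [nsmul_eq_mul, ← mul_assoc]
  symm
  refine finsum_cond_eq_sum_of_cond_iff _ fun {P} hP => ⟨fun _ => ?_, fun hmem => ?_⟩
  · by_contra hmem
    have hempty : (Finset.univ.filter fun π : Finpartition (Finset.univ : Finset (Fin N)) =>
        collapsePartition c π = P) = ∅ :=
      Finset.filter_eq_empty_iff.2 fun π _ h =>
        hmem (Finset.mem_image.2 ⟨π, Finset.mem_univ _, h⟩)
    simp [hempty] at hP
  · obtain ⟨π, -, rfl⟩ := Finset.mem_image.1 hmem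
    exact ⟨hsum π, hzero π⟩
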